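/- The space Λ_{p̂} has the coordinatewise uniform Kadec–Klee property: for every ε ∈ (0,1) there exists δ > 0 such that whenever x ∈ Λ_{p̂} and (x_l)_{l∈ℕ} is a sequence in Λ_{p̂} with ‖x_l‖_{p̂} ≤ 1 for all l, sep(x_l) := inf{‖x_l − x_m‖_{p̂} : l ≠ m} ≥ ε, ‖x_l‖_{p̂} → ‖x‖_{p̂} as l → ∞, and x_{l,i} → x_i as l → ∞ for each coordinate i, then ‖x‖_{p̂} ≤ 1 − δ. -/

import Mathlib

open Filter Topology

/-- Weight `λ_k − λ_{k−1}` with the convention `λ_{−1} = 0`. -/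
noncomputable def dLam (l : ℕ → ℝ) (k : ℕ) : ℝ :=
  l k - (if k = 0 then 0 else l (k - 1))

/-- `Λx(n) = (1/λ_n) ∑_{k=0}^n (λ_k − λ_{k−1})|x_k|`. -/
noncomputable def LamAvg (l : ℕ → ℝ) (x : ℕ → ℝ) (n : ℕ) : ℝ :=
  (1 / l n) * ∑ k ∈ Finset.range (n + 1), dLam l k * |x k|

/-- The modular `σ(x) = ∑_{n=0}^∞ (Λx(n))^{p_n}`. -/
noncomputable def sigmaMod (l pp : ℕ → ℝ) (x : ℕ → ℝ) : ℝ :=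
  ∑' n : ℕ, (LamAvg l x n) ^ (pp n)

/-- The modular of `x` is finite (the defining series converges). -/
def FiniteMod (l pp : ℕ → ℝ) (x : ℕ → ℝ) : Prop :=
  Summable fun n : ℕ => (LamAvg l x n) ^ (pp n)

/-- Membership in `Λ_{p̂}` : `σ(rx) < ∞` for some `r > 0`. -/
def MemLam (l pp : ℕ → ℝ) (x : ℕ → ℝ) : Prop :=
  ∃ r : ℝ, 0 < r ∧ FiniteMod l pp (fun k => r * x k)

/-- The Luxemburg norm `‖x‖_{p̂} = inf { r > 0 : σ(x/r) ≤ 1 }`. -/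
noncomputable def luxNorm (l pp : ℕ → ℝ) (x : ℕ → ℝ) : ℝ :=
  sInf {r : ℝ | 0 < r ∧ FiniteMod l pp (fun k => x k / r) ∧
    sigmaMod l pp (fun k => x k / r) ≤ 1}

section LamAvg

variable {l : ℕ → ℝ}

lemma dLam_nonneg (hpos : ∀ k, 0 < l k) (hmono : StrictMono l) (k : ℕ) : 0 ≤ dLam l k := by
  unfold dLam
  split_ifs with h
  · simpa using (hpos k).le
  · exact sub_nonneg.2 (hmono.monotone (Nat.sub_le k 1))

lemma LamAvg_nonneg (hpos : ∀ k, 0 < l k) (hmono : StrictMono l) (x : ℕ → ℝ) (n : ℕ) :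
    0 ≤ LamAvg l x n :=
  mul_nonneg (one_div_nonneg.2 (hpos n).le)
    (Finset.sum_nonneg fun k _ => mul_nonneg (dLam_nonneg hpos hmono k) (abs_nonneg _))

lemma LamAvg_const_mul (c : ℝ) (x : ℕ → ℝ) (n : ℕ) :
    LamAvg l (fun k => c * x k) n = |c| * LamAvg l x n := by
  simp only [LamAvg, abs_mul, Finset.mul_sum]
  exact Finset.sum_congr rfl fun k _ => by ring

lemma LamAvg_sub_le (hpos : ∀ k, 0 < l k) (hmono : StrictMono l) (x y : ℕ → ℝ) (n : ℕ) :
    LamAvg l (x - y) n ≤ LamAvg l x n + LamAvg l y n := by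
  simp only [LamAvg, ← mul_add, ← Finset.sum_add_distrib]
  refine mul_le_mul_of_nonneg_left (Finset.sum_le_sum fun k _ => ?_)
    (one_div_nonneg.2 (hpos n).le)
  exact mul_le_mul_of_nonneg_left (abs_sub _ _) (dLam_nonneg hpos hmono k)

lemma tendsto_LamAvg {xs : ℕ → ℕ → ℝ} {x : ℕ → ℝ}
    (h : ∀ k, Tendsto (fun i => xs i k) atTop (𝓝 (x k))) (n : ℕ) :
    Tendsto (fun i => LamAvg l (xs i) n) atTop (𝓝 (LamAvg l x n)) :=
  (tendsto_finsetSum _ fun k _ => ((h k).abs.const_mul _)).const_mul _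

end LamAvg

lemma add_rpow_le_two_rpow_mul {a b p M : ℝ} (ha : 0 ≤ a) (hb : 0 ≤ b) (hp : 0 ≤ p) (hM : p ≤ M) :
    (a + b) ^ p ≤ 2 ^ M * (a ^ p + b ^ p) := by
  have hmax : max a b ^ p ≤ a ^ p + b ^ p := by
    have := Real.rpow_nonneg ha p
    have := Real.rpow_nonneg hb p
    rcases max_choice a b with h | h <;> rw [h] <;> linarith
  calc (a + b) ^ p ≤ (2 * max a b) ^ p :=
        Real.rpow_le_rpow (by positivity)
          (by linarith [le_max_left a b, le_max_right a b]) hp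
    _ = 2 ^ p * max a b ^ p := Real.mul_rpow (by norm_num) (ha.trans (le_max_left _ _))
    _ ≤ 2 ^ M * (a ^ p + b ^ p) :=
        mul_le_mul (Real.rpow_le_rpow_of_exponent_le (by norm_num) hM) hmax
          (Real.rpow_nonneg (ha.trans (le_max_left _ _)) _) (by positivity)

section Modular

variable {l pp : ℕ → ℝ} {M : ℝ}

lemma LamAvg_rpow_sub_le (hpos : ∀ k, 0 < l k) (hmono : StrictMono l) (hpp : ∀ n, 1 < pp n)
    (hM : ∀ n, pp n ≤ M) (x y : ℕ → ℝ) (n : ℕ) :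
    LamAvg l (x - y) n ^ pp n ≤ 2 ^ M * (LamAvg l x n ^ pp n + LamAvg l y n ^ pp n) := by
  have hp : 0 ≤ pp n := by linarith [hpp n]
  exact (Real.rpow_le_rpow (LamAvg_nonneg hpos hmono _ n) (LamAvg_sub_le hpos hmono x y n) hp).trans
    (add_rpow_le_two_rpow_mul (LamAvg_nonneg hpos hmono x n) (LamAvg_nonneg hpos hmono y n) hp
      (hM n))

lemma FiniteMod.sub (hpos : ∀ k, 0 < l k) (hmono : StrictMono l) (hpp : ∀ n, 1 < pp n)
    (hM : ∀ n, pp n ≤ M) {x y : ℕ → ℝ} (hx : FiniteMod l pp x) (hy : FiniteMod l pp y) :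
    FiniteMod l pp (x - y) :=
  Summable.of_nonneg_of_le (fun n => Real.rpow_nonneg (LamAvg_nonneg hpos hmono _ n) _)
    (LamAvg_rpow_sub_le hpos hmono hpp hM x y) ((Summable.add hx hy).mul_left _)

lemma sigmaMod_sub_le (hpos : ∀ k, 0 < l k) (hmono : StrictMono l) (hpp : ∀ n, 1 < pp n)
    (hM : ∀ n, pp n ≤ M) {x y : ℕ → ℝ} (hx : FiniteMod l pp x) (hy : FiniteMod l pp y) :
    sigmaMod l pp (x - y) ≤ 2 ^ M * (sigmaMod l pp x + sigmaMod l pp y) := by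
  unfold sigmaMod
  rw [← Summable.tsum_add hx hy, ← tsum_mul_left]
  exact Summable.tsum_le_tsum (LamAvg_rpow_sub_le hpos hmono hpp hM x y)
    (hx.sub hpos hmono hpp hM hy) ((Summable.add hx hy).mul_left _)

lemma LamAvg_rpow_const_mul_le (hpos : ∀ k, 0 < l k) (hmono : StrictMono l) (hpp : ∀ n, 1 < pp n)
    (hM : ∀ n, pp n ≤ M) {c C : ℝ} (hc : 0 ≤ c) (hcC : c ≤ C) (hC : 1 ≤ C) (x : ℕ → ℝ) (n : ℕ) :
    LamAvg l (fun k => c * x k) n ^ pp n ≤ C ^ M * LamAvg l x n ^ pp n := by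
  rw [LamAvg_const_mul, abs_of_nonneg hc, Real.mul_rpow hc (LamAvg_nonneg hpos hmono x n)]
  refine mul_le_mul_of_nonneg_right ?_ (Real.rpow_nonneg (LamAvg_nonneg hpos hmono x n) _)
  exact (Real.rpow_le_rpow hc hcC (by linarith [hpp n])).trans
    (Real.rpow_le_rpow_of_exponent_le hC (hM n))

lemma FiniteMod.const_mul (hpos : ∀ k, 0 < l k) (hmono : StrictMono l) (hpp : ∀ n, 1 < pp n)
    (hM : ∀ n, pp n ≤ M) {c : ℝ} (hc : 0 ≤ c) {x : ℕ → ℝ} (hx : FiniteMod l pp x) :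
    FiniteMod l pp (fun k => c * x k) :=
  Summable.of_nonneg_of_le (fun n => Real.rpow_nonneg (LamAvg_nonneg hpos hmono _ n) _)
    (LamAvg_rpow_const_mul_le hpos hmono hpp hM hc (le_max_left c 1) (le_max_right c 1) x)
    (Summable.mul_left _ hx)

lemma sigmaMod_const_mul_le (hpos : ∀ k, 0 < l k) (hmono : StrictMono l) (hpp : ∀ n, 1 < pp n)
    (hM : ∀ n, pp n ≤ M) {c C : ℝ} (hc : 0 ≤ c) (hcC : c ≤ C) (hC : 1 ≤ C) {x : ℕ → ℝ}
    (hx : FiniteMod l pp x) :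
    sigmaMod l pp (fun k => c * x k) ≤ C ^ M * sigmaMod l pp x := by
  unfold sigmaMod
  rw [← tsum_mul_left]
  exact Summable.tsum_le_tsum (LamAvg_rpow_const_mul_le hpos hmono hpp hM hc hcC hC x)
    (hx.const_mul hpos hmono hpp hM hc) (Summable.mul_left _ hx)

lemma MemLam.finiteMod (hpos : ∀ k, 0 < l k) (hmono : StrictMono l) (hpp : ∀ n, 1 < pp n)
    (hM : ∀ n, pp n ≤ M) {x : ℕ → ℝ} (hx : MemLam l pp x) : FiniteMod l pp x := by
  obtain ⟨r, hr, h⟩ := hx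
  have := h.const_mul hpos hmono hpp hM (inv_nonneg.2 hr.le)
  simpa only [inv_mul_cancel_left₀ hr.ne'] using this

lemma luxNorm_le (hpos : ∀ k, 0 < l k) (hmono : StrictMono l) (hpp : ∀ n, 1 < pp n)
    (hM : ∀ n, pp n ≤ M) {x : ℕ → ℝ} (hx : FiniteMod l pp x) {r : ℝ} (hr : 0 < r) (hr1 : r ≤ 1)
    (h : sigmaMod l pp x ≤ r ^ M) : luxNorm l pp x ≤ r := by
  have hdiv : (fun k => x k / r) = fun k => r⁻¹ * x k := by
    funext k
    rw [div_eq_inv_mul]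
  refine csInf_le ⟨0, fun _ hs => hs.1.le⟩ ⟨hr, ?_, ?_⟩
  · rw [hdiv]
    exact hx.const_mul hpos hmono hpp hM (inv_nonneg.2 hr.le)
  · rw [hdiv]
    calc _ ≤ r⁻¹ ^ M * sigmaMod l pp x :=
          sigmaMod_const_mul_le hpos hmono hpp hM (inv_nonneg.2 hr.le) le_rfl
            ((one_le_inv₀ hr).2 hr1) hx
      _ ≤ r⁻¹ ^ M * r ^ M := mul_le_mul_of_nonneg_left h (by positivity)
      _ = 1 := by
          rw [← Real.mul_rpow (inv_nonneg.2 hr.le) hr.le, inv_mul_cancel₀ hr.ne', Real.one_rpow]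

lemma exists_modular_scaling (hpos : ∀ k, 0 < l k) (hmono : StrictMono l) (hpp : ∀ n, 1 < pp n)
    (hM : ∀ n, pp n ≤ M) {x : ℕ → ℝ} (hx : FiniteMod l pp x) :
    ∃ r : ℝ, 0 < r ∧ FiniteMod l pp (fun k => x k / r) ∧ sigmaMod l pp (fun k => x k / r) ≤ 1 := by
  set S := sigmaMod l pp x
  have hS : 0 ≤ S := tsum_nonneg fun n => Real.rpow_nonneg (LamAvg_nonneg hpos hmono x n) _
  have hr : 0 < S + 1 := by linarith
  have hdiv : (fun k => x k / (S + 1)) = fun k => (S + 1)⁻¹ * x k := by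
    funext k
    rw [div_eq_inv_mul]
  have hfin := hx.const_mul hpos hmono hpp hM (inv_nonneg.2 hr.le)
  refine ⟨S + 1, hr, hdiv ▸ hfin, ?_⟩
  rw [hdiv]
  calc _ ≤ ∑' n, (S + 1)⁻¹ * LamAvg l x n ^ pp n := by
        refine Summable.tsum_le_tsum (fun n => ?_) hfin (Summable.mul_left _ hx)
        rw [LamAvg_const_mul, abs_of_nonneg (inv_nonneg.2 hr.le),
          Real.mul_rpow (inv_nonneg.2 hr.le) (LamAvg_nonneg hpos hmono x n)]
        refine mul_le_mul_of_nonneg_right ?_ (Real.rpow_nonneg (LamAvg_nonneg hpos hmono x n) _)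
        simpa using Real.rpow_le_rpow_of_exponent_ge (inv_pos.2 hr)
          (inv_le_one_of_one_le₀ (by linarith)) (hpp n).le
    _ = (S + 1)⁻¹ * S := tsum_mul_left
    _ ≤ 1 := by
        rw [inv_mul_le_iff₀ hr]
        linarith

lemma sigmaMod_le_one (hpos : ∀ k, 0 < l k) (hmono : StrictMono l) (hpp : ∀ n, 1 < pp n)
    (hM : ∀ n, pp n ≤ M) {x : ℕ → ℝ} (hx : FiniteMod l pp x) (h : luxNorm l pp x ≤ 1) :
    sigmaMod l pp x ≤ 1 := by
  have hM0 : 0 ≤ M := by linarith [hpp 0, hM 0]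
  have key : ∀ C : ℝ, 1 < C → sigmaMod l pp x ≤ C ^ M := by
    intro C hC
    obtain ⟨r, ⟨hr, hfin, hle⟩, hrC⟩ :=
      exists_lt_of_csInf_lt (exists_modular_scaling hpos hmono hpp hM hx) (h.trans_lt hC)
    have := sigmaMod_const_mul_le hpos hmono hpp hM hr.le hrC.le hC.le hfin
    simp only [mul_div_cancel₀ _ hr.ne'] at this
    exact this.trans (mul_le_of_le_one_right (by positivity) hle)
  have hlim : Tendsto (fun C : ℝ => C ^ M) (𝓝[>] 1) (𝓝 1) := by
    have := (Real.continuousAt_rpow_const 1 M (Or.inr hM0)).tendsto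
    rw [Real.one_rpow] at this
    exact this.mono_left nhdsWithin_le_nhds
  exact ge_of_tendsto hlim (by filter_upwards [self_mem_nhdsWithin] with C hC using key C hC)

/-- A coordinatewise limit of elements of the unit ball that stay modularly `η`-far from the limit
has modular bounded away from `1`. -/
lemma sigmaMod_le_of_frequently_far (hpos : ∀ k, 0 < l k) (hmono : StrictMono l)
    (hpp : ∀ n, 1 < pp n) (hM : ∀ n, pp n ≤ M) {x : ℕ → ℝ} {xs : ℕ → ℕ → ℝ} {η : ℝ}
    (hx : FiniteMod l pp x) (hxs : ∀ i, FiniteMod l pp (xs i))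
    (hball : ∀ i, sigmaMod l pp (xs i) ≤ 1)
    (hlim : ∀ k, Tendsto (fun i => xs i k) atTop (𝓝 (x k)))
    (hfar : ∃ᶠ i in atTop, η ≤ sigmaMod l pp (xs i - x)) :
    2 ^ M * (sigmaMod l pp x - 1) + η ≤ 0 := by
  have hK : (0 : ℝ) < 2 ^ M := by positivity
  have hsmall : ∀ s > 0, 2 ^ M * (sigmaMod l pp x - 1) + η ≤ (3 * 2 ^ M + 1) * s := by
    intro s hs
    have htail := (tendsto_sum_nat_add fun n => LamAvg l x n ^ pp n).eventually (gt_mem_nhds hs)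
    obtain ⟨N, hN⟩ := htail.exists
    have hhead : Tendsto (fun i => ∑ n ∈ Finset.range N, LamAvg l (xs i) n ^ pp n) atTop
        (𝓝 (∑ n ∈ Finset.range N, LamAvg l x n ^ pp n)) :=
      tendsto_finsetSum _ fun n _ =>
        (tendsto_LamAvg hlim n).rpow_const (Or.inr (by linarith [hpp n]))
    have hdiff : Tendsto (fun i => ∑ n ∈ Finset.range N, LamAvg l (xs i - x) n ^ pp n) atTop
        (𝓝 0) := by
      have hsub : ∀ k, Tendsto (fun i => (xs i - x) k) atTop (𝓝 ((0 : ℕ → ℝ) k)) := fun k => by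
        simpa using (hlim k).sub_const (x k)
      have hzero : ∑ n ∈ Finset.range N, LamAvg l 0 n ^ pp n = 0 :=
        Finset.sum_eq_zero fun n _ => by
          simp [LamAvg, Real.zero_rpow (show pp n ≠ 0 by linarith [hpp n])]
      rw [← hzero]
      exact tendsto_finsetSum _ fun n _ =>
        (tendsto_LamAvg hsub n).rpow_const (Or.inr (by linarith [hpp n]))
    obtain ⟨i, hi, hi1, hi2⟩ := (hfar.and_eventually ((hhead.eventually (lt_mem_nhds
      (sub_lt_self _ hs))).and (hdiff.eventually (gt_mem_nhds hs)))).exists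
    have hxT := (summable_nat_add_iff N).2 hx
    have hxsT := (summable_nat_add_iff N).2 (hxs i)
    have hdfin := (hxs i).sub hpos hmono hpp hM hx
    have htailsub : ∑' n, LamAvg l (xs i - x) (n + N) ^ pp (n + N) ≤
        2 ^ M * (∑' n, LamAvg l (xs i) (n + N) ^ pp (n + N) +
          ∑' n, LamAvg l x (n + N) ^ pp (n + N)) := by
      rw [← Summable.tsum_add hxsT hxT, ← tsum_mul_left]
      exact Summable.tsum_le_tsum (fun n => LamAvg_rpow_sub_le hpos hmono hpp hM _ _ (n + N))
        ((summable_nat_add_iff N).2 hdfin) ((Summable.add hxsT hxT).mul_left _)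
    have hsx := hx.sum_add_tsum_nat_add N
    have hsxs := (hxs i).sum_add_tsum_nat_add N
    have hsd := hdfin.sum_add_tsum_nat_add N
    have hb := hball i
    simp only [sigmaMod] at hi hb ⊢
    rw [← hsx]
    rw [← hsxs] at hb
    rw [← hsd] at hi
    nlinarith
  refine le_of_forall_pos_le_add fun e he => ?_
  have h := hsmall (e / (3 * 2 ^ M + 1)) (by positivity)
  rw [mul_div_cancel₀ _ (by positivity)] at h
  linarith

end Modular

/-- `Λ_{p̂}` has the coordinatewise uniform Kadec–Klee property. -/
theorem LamPhat_UKKc (l pp : ℕ → ℝ)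
    (hpos : ∀ k, 0 < l k) (hmono : StrictMono l)
    (htop : Tendsto l atTop atTop)
    (hratio : Tendsto (fun k => l (k + 1) / l k) atTop (𝓝 1))
    (hpp : ∀ n, 1 < pp n) (hbdd : ∃ M : ℝ, ∀ n, pp n ≤ M) :
    ∀ ε : ℝ, 0 < ε → ε < 1 → ∃ δ : ℝ, 0 < δ ∧
      ∀ x : ℕ → ℝ, MemLam l pp x →
      ∀ xs : ℕ → ℕ → ℝ, (∀ i, MemLam l pp (xs i)) → (∀ i, luxNorm l pp (xs i) ≤ 1) →
        (∀ i j, i ≠ j → ε ≤ luxNorm l pp (xs i - xs j)) →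
        Tendsto (fun i => luxNorm l pp (xs i)) atTop (𝓝 (luxNorm l pp x)) →
        (∀ k : ℕ, Tendsto (fun i => xs i k) atTop (𝓝 (x k))) →
        luxNorm l pp x ≤ 1 - δ := by
  intro ε hε hε1
  obtain ⟨M, hM⟩ := hbdd
  have hM1 : 1 < M := (hpp 0).trans_le (hM 0)
  set K : ℝ := 2 ^ M with hKdef
  have hK : 1 ≤ K := Real.one_le_rpow (by norm_num) (by linarith)
  set η : ℝ := (ε / 2) ^ M / (2 * K) with hη
  have hη0 : 0 < η := by positivity
  have hεM : (ε / 2) ^ M ≤ 1 := Real.rpow_le_one (by positivity) (by linarith) (by linarith)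
  have hηK : η / K < 1 := by
    rw [hη, div_div, div_lt_one (by positivity)]
    nlinarith
  have hbase : 0 < 1 - η / K := by linarith
  have hbase1 : 1 - η / K < 1 := by linarith [show 0 < η / K by positivity]
  refine ⟨1 - (1 - η / K) ^ M⁻¹,
    sub_pos.2 (Real.rpow_lt_one hbase.le hbase1 (by positivity)), ?_⟩
  intro x hx xs hxs hball hsep _ hlim
  have hxf := hx.finiteMod hpos hmono hpp hM
  have hxsf := fun i => (hxs i).finiteMod hpos hmono hpp hM
  have hfar : ∃ᶠ i in atTop, η ≤ sigmaMod l pp (xs i - x) := by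
    intro hnear
    obtain ⟨a, ha⟩ := eventually_atTop.1 hnear
    have h1 := not_le.1 (ha a le_rfl)
    have h2 := not_le.1 (ha (a + 1) (Nat.le_succ a))
    have hf := fun i => (hxsf i).sub hpos hmono hpp hM hxf
    have hle := sigmaMod_sub_le hpos hmono hpp hM (hf a) (hf (a + 1))
    have hηeq : K * (2 * η) = (ε / 2) ^ M := by
      rw [hη]
      field_simp
    have hlux := luxNorm_le hpos hmono hpp hM ((hf a).sub hpos hmono hpp hM (hf (a + 1)))
      (half_pos hε) (by linarith) (hle.trans (by rw [← hηeq]; gcongr; linarith))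
    rw [sub_sub_sub_cancel_right] at hlux
    linarith [hsep a (a + 1) (by omega)]
  have hσ := sigmaMod_le_of_frequently_far hpos hmono hpp hM hxf hxsf
    (fun i => sigmaMod_le_one hpos hmono hpp hM (hxsf i) (hball i)) hlim hfar
  rw [sub_sub_cancel]
  refine luxNorm_le hpos hmono hpp hM hxf (by positivity)
    (Real.rpow_le_one hbase.le hbase1.le (by positivity)) ?_
  rw [Real.rpow_inv_rpow hbase.le (by linarith), le_sub_comm, div_le_iff₀ (by positivity)]
  linarith
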